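/- Fix an integer ℓ ≥ 1 and let T^ℓ be the graph consisting of a path v_1, v_2, …, v_{2ℓ+3} together with, for each j with 1 ≤ j ≤ ℓ+1, an extra vertex u_{2j} adjacent only to v_{2j}. Let k = ℓ + 2, let V_s = {v_1, v_2, v_4, v_6, …, v_{2ℓ+2}} and V_t = {v_2, v_4, v_6, …, v_{2ℓ+2}, v_{2ℓ+3}} (both vertex covers of T^ℓ of size k). Then every reconfiguration sequence from V_s to V_t under (k,1)-Token Jumping, in which every configuration is a vertex cover of T^ℓ of size k, has at least ℓ + 1 moves. -/

import Mathlib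

/-- A vertex cover of a simple graph: every edge has an endpoint in the set. -/
def IsVC {V : Type*} (G : SimpleGraph V) (S : Finset V) : Prop :=
  ∀ ⦃u v : V⦄, G.Adj u v → u ∈ S ∨ v ∈ S

/-- The vertex set of the gadget `T^ℓ`: `Sum.inl i` is the path vertex `v_{i+1}`
(for `0 ≤ i ≤ 2ℓ+2`), and `Sum.inr j` is the pendant vertex `u_{2(j+1)}`
(for `0 ≤ j ≤ ℓ`). -/
abbrev TVert (ℓ : ℕ) := Fin (2 * ℓ + 3) ⊕ Fin (ℓ + 1)

/-- The gadget graph `T^ℓ`: a path `v_1, …, v_{2ℓ+3}` together with, for each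
`1 ≤ j ≤ ℓ+1`, an extra vertex `u_{2j}` adjacent only to `v_{2j}`. -/
def Tgraph (ℓ : ℕ) : SimpleGraph (TVert ℓ) :=
  SimpleGraph.fromRel (fun x y =>
    match x, y with
    | Sum.inl i, Sum.inl i' => (i' : ℕ) = (i : ℕ) + 1
    | Sum.inl i, Sum.inr j => (i : ℕ) = 2 * (j : ℕ) + 1
    | _, _ => False)

/-- The vertices `v_2, v_4, …, v_{2ℓ+2}` of `T^ℓ` (indices `1, 3, …, 2ℓ+1`). -/
def TEvens (ℓ : ℕ) : Finset (TVert ℓ) :=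
  Finset.image
    (fun j : Fin (ℓ + 1) =>
      Sum.inl ⟨2 * (j : ℕ) + 1, by have := j.isLt; omega⟩)
    Finset.univ

/-- The starting configuration `V_s = {v_1, v_2, v_4, …, v_{2ℓ+2}}`. -/
def TVs (ℓ : ℕ) : Finset (TVert ℓ) :=
  insert (Sum.inl ⟨0, by omega⟩) (TEvens ℓ)

/-- The target configuration `V_t = {v_2, v_4, …, v_{2ℓ+2}, v_{2ℓ+3}}`. -/
def TVt (ℓ : ℕ) : Finset (TVert ℓ) :=
  insert (Sum.inl ⟨2 * ℓ + 2, by omega⟩) (TEvens ℓ)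

/-- A `(k, 1)`-Token Jumping move from `C` to `C'`: a bijection under which every token
stays put or slides to an adjacent vertex. -/
def AllSlideMove {V : Type*} (G : SimpleGraph V) (C C' : Finset V) : Prop :=
  ∃ f : V → V, Set.BijOn f ↑C ↑C' ∧ ∀ v ∈ C, f v = v ∨ G.Adj v (f v)

/-- The horizontal position of a vertex of `T^ℓ`; a pendant vertex sits over its neighbour. -/
def TPos {ℓ : ℕ} : TVert ℓ → ℕ
  | Sum.inl i => i
  | Sum.inr j => 2 * j + 1

lemma TPos_le_of_adj {ℓ : ℕ} {x y : TVert ℓ} (h : (Tgraph ℓ).Adj x y) :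
    TPos y ≤ TPos x + 1 := by
  rw [Tgraph, SimpleGraph.fromRel_adj] at h
  obtain ⟨-, h⟩ := h
  rcases x with i | i <;> rcases y with j | j <;> simp_all [TPos] <;> omega

lemma inl_mem_TEvens {ℓ : ℕ} (i : Fin (2 * ℓ + 3)) :
    (Sum.inl i : TVert ℓ) ∈ TEvens ℓ ↔ (i : ℕ) % 2 = 1 := by
  simp only [TEvens, Finset.mem_image, Finset.mem_univ, true_and, Sum.inl.injEq, Fin.ext_iff]
  constructor
  · rintro ⟨j, hj⟩
    omega
  · intro h
    exact ⟨⟨i / 2, by omega⟩, by simp only; omega⟩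

lemma inr_notMem_TEvens {ℓ : ℕ} (j : Fin (ℓ + 1)) : (Sum.inr j : TVert ℓ) ∉ TEvens ℓ := by
  simp [TEvens]

lemma card_TEvens (ℓ : ℕ) : (TEvens ℓ).card = ℓ + 1 := by
  rw [TEvens, Finset.card_image_of_injective, Finset.card_univ, Fintype.card_fin]
  intro i j h
  simp only [Sum.inl.injEq, Fin.mk.injEq] at h
  omega

/-- Every edge of `T^ℓ` has exactly one endpoint among `v_2, v_4, …, v_{2ℓ+2}`. -/
lemma mem_TEvens_iff_notMem_of_adj {ℓ : ℕ} {x y : TVert ℓ} (h : (Tgraph ℓ).Adj x y) :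
    x ∈ TEvens ℓ ↔ y ∉ TEvens ℓ := by
  rw [Tgraph, SimpleGraph.fromRel_adj] at h
  obtain ⟨-, h⟩ := h
  rcases x with i | i <;> rcases y with j | j <;>
    simp_all [inl_mem_TEvens, inr_notMem_TEvens] <;> omega

/-- A vertex cover of `T^ℓ` of size `ℓ + 2` contains `v_2, v_4, …, v_{2ℓ+2}`. -/
lemma TEvens_subset_of_isVC {ℓ : ℕ} {C : Finset (TVert ℓ)} (hC : IsVC (Tgraph ℓ) C)
    (hcard : C.card = ℓ + 2) : TEvens ℓ ⊆ C := by
  let v : Fin (ℓ + 1) → TVert ℓ := fun j => Sum.inl ⟨2 * (j : ℕ) + 1, by have := j.isLt; omega⟩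
  suffices hv : ∀ j, v j ∈ C by
    intro x hx
    obtain ⟨j, -, rfl⟩ := Finset.mem_image.1 hx
    exact hv j
  intro j
  by_contra hj
  let l : TVert ℓ := Sum.inl ⟨2 * (j : ℕ), by omega⟩
  let r : TVert ℓ := Sum.inl ⟨2 * (j : ℕ) + 2, by omega⟩
  have hl : l ∈ C :=
    (hC (u := v j) (v := l) (by simp [Tgraph, v, l])).resolve_left hj
  have hr : r ∈ C :=
    (hC (u := v j) (v := r) (by simp [Tgraph, v, r])).resolve_left hj
  let h : Fin (ℓ + 1) → TVert ℓ := fun i => if v i ∈ C then v i else Sum.inr i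
  have hpos : ∀ i, TPos (h i) = 2 * i + 1 := by
    intro i
    simp only [h]
    split_ifs <;> rfl
  have hmem : ∀ i, h i ∈ C := by
    intro i
    simp only [h]
    split_ifs with hi
    · exact hi
    · exact (hC (u := v i) (v := Sum.inr i) (by simp [Tgraph, v])).resolve_left hi
  have hinj : Function.Injective h := by
    intro a b hab
    have := congrArg TPos hab
    rw [hpos, hpos] at this
    omega
  have hr' : r ∉ Finset.univ.image h := by
    simp only [Finset.mem_image, Finset.mem_univ, true_and, not_exists]
    intro i hi
    have := congrArg TPos hi
    rw [hpos] at this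
    simp only [TPos, r] at this
    omega
  have hl' : l ∉ insert r (Finset.univ.image h) := by
    simp only [Finset.mem_insert, Finset.mem_image, Finset.mem_univ, true_and, not_or, not_exists]
    refine ⟨by simp [l, r], fun i hi => ?_⟩
    have := congrArg TPos hi
    rw [hpos] at this
    simp only [TPos, l] at this
    omega
  have hsub : insert l (insert r (Finset.univ.image h)) ⊆ C := by
    simp only [Finset.insert_subset_iff, Finset.image_subset_iff]
    exact ⟨hl, hr, fun i _ => hmem i⟩
  have := Finset.card_le_card hsub
  rw [Finset.card_insert_of_notMem hl', Finset.card_insert_of_notMem hr',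
    Finset.card_image_of_injective _ hinj, Finset.card_univ, Fintype.card_fin] at this
  omega

lemma exists_eq_insert_TEvens {ℓ : ℕ} {C : Finset (TVert ℓ)} (hC : IsVC (Tgraph ℓ) C)
    (hcard : C.card = ℓ + 2) : ∃ x ∉ TEvens ℓ, insert x (TEvens ℓ) = C :=
  Finset.exists_eq_insert_iff.2
    ⟨TEvens_subset_of_isVC hC hcard, by rw [card_TEvens, hcard]⟩

/-- A single move advances the token outside `v_2, v_4, …, v_{2ℓ+2}` by at most two positions. -/
lemma TPos_le_of_allSlideMove {ℓ : ℕ} {x y : TVert ℓ} (hx : x ∉ TEvens ℓ)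
    (h : AllSlideMove (Tgraph ℓ) (insert x (TEvens ℓ)) (insert y (TEvens ℓ))) :
    TPos y ≤ TPos x + 2 := by
  obtain ⟨f, hf, hstep⟩ := h
  have hmaps : ∀ z ∈ insert x (TEvens ℓ), f z = y ∨ f z ∈ TEvens ℓ := fun z hz =>
    Finset.mem_insert.1 (hf.mapsTo hz)
  have hxC : x ∈ insert x (TEvens ℓ) := Finset.mem_insert_self _ _
  rcases hstep x hxC with hfx | hfx
  · rcases hmaps x hxC with h | h
    · rw [← h, hfx]
      omega
    · exact absurd (hfx ▸ h) hx
  · have he : f x ∈ TEvens ℓ := by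
      by_contra hne
      exact hx ((mem_TEvens_iff_notMem_of_adj hfx).2 hne)
    have heC : f x ∈ insert x (TEvens ℓ) := Finset.mem_insert_of_mem he
    rcases hstep (f x) heC with hfe | hfe
    · exact absurd (hf.injOn heC hxC hfe ▸ he) hx
    · have hy : f (f x) = y :=
        (hmaps _ heC).resolve_right ((mem_TEvens_iff_notMem_of_adj hfe).1 he)
      have h₁ := TPos_le_of_adj hfx
      have h₂ := TPos_le_of_adj hfe
      rw [hy] at h₂
      omega

theorem statement_19 (ℓ : ℕ) (hℓ : 1 ≤ ℓ) :
    ∀ (m : ℕ) (C : ℕ → Finset (TVert ℓ)),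
      C 0 = TVs ℓ → C m = TVt ℓ →
      (∀ i ≤ m, IsVC (Tgraph ℓ) (C i) ∧ (C i).card = ℓ + 2) →
      (∀ i < m, AllSlideMove (Tgraph ℓ) (C i) (C (i + 1))) →
      ℓ + 1 ≤ m := by
  intro m C h0 hm hC hmove
  have key : ∀ i ≤ m, ∃ x ∉ TEvens ℓ, insert x (TEvens ℓ) = C i ∧ TPos x ≤ 2 * i := by
    intro i
    induction i with
    | zero =>
      intro _
      exact ⟨Sum.inl ⟨0, by omega⟩, by simp [inl_mem_TEvens], h0.symm, by simp [TPos]⟩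
    | succ i ih =>
      intro hi
      obtain ⟨x, hx, hxC, hpos⟩ := ih (by omega)
      obtain ⟨y, hy, hyC⟩ := exists_eq_insert_TEvens (hC _ hi).1 (hC _ hi).2
      have hstep := hmove i (by omega)
      rw [← hxC, ← hyC] at hstep
      have := TPos_le_of_allSlideMove hx hstep
      exact ⟨y, hy, hyC, by omega⟩
  obtain ⟨x, hx, hxC, hpos⟩ := key m le_rfl
  have hmem : x ∈ TVt ℓ := hm ▸ hxC ▸ Finset.mem_insert_self _ _
  rcases Finset.mem_insert.1 hmem with rfl | h
  · simp only [TPos] at hpos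
    omega
  · exact absurd h hx
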